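/- Let d ≥ 1, let Ω, Ω' ⊆ ℝ^d × ℝ, and let R ≥ 0 be such that for every ω' ∈ Ω' there exists ω ∈ Ω with ‖ω' − ω‖ ≤ R (Euclidean norm on ℝ^{d+1}). Suppose (v,s) ∈ ℝ^d × ℝ, c > 0 and K ≥ 0 satisfy: for every (h,t) ∈ Ω with |t| > K, sign(t)(⟨v,h⟩ + s·t) ≥ c·|t|. Then (v,s) belongs to the asymptotic dual cone C(Ω'). -/

import Mathlib

open scoped RealInnerProductSpace

/-- The asymptotic dual cone of a subset `Ω ⊆ ℝ^d × ℝ`: the set of pairs `(v, s)` for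
which there exists `K > 0` such that `sign(t) (⟨v, h⟩ + s t) > 0` for every
`(h, t) ∈ Ω` with `|t| > K`. -/
noncomputable def asympDualCone (d : ℕ) (Ω : Set (EuclideanSpace ℝ (Fin d) × ℝ)) :
    Set (EuclideanSpace ℝ (Fin d) × ℝ) :=
  {p | ∃ K > (0 : ℝ), ∀ q ∈ Ω, K < |q.2| →
    0 < Real.sign q.2 * (⟪p.1, q.1⟫ + p.2 * q.2)}

/-- If `Ω'` lies within (Euclidean) distance `R` of `Ω`, and the affine functional
`(h, t) ↦ ⟨v, h⟩ + s t` satisfies the quantitative positivity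
`sign(t)(⟨v, h⟩ + s t) ≥ c |t|` on `Ω` for `|t| > K`, then `(v, s)` belongs to the
asymptotic dual cone of `Ω'`. -/
theorem mem_asympDualCone_of_quantitative (d : ℕ) (hd : 1 ≤ d)
    (Ω Ω' : Set (EuclideanSpace ℝ (Fin d) × ℝ)) (R : ℝ) (hR : 0 ≤ R)
    (hclose : ∀ q' ∈ Ω', ∃ q ∈ Ω, ‖q'.1 - q.1‖ ^ 2 + (q'.2 - q.2) ^ 2 ≤ R ^ 2)
    (v : EuclideanSpace ℝ (Fin d)) (s c K : ℝ) (hc : 0 < c) (hK : 0 ≤ K)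
    (hlin : ∀ q ∈ Ω, K < |q.2| → c * |q.2| ≤ Real.sign q.2 * (⟪v, q.1⟫ + s * q.2)) :
    (v, s) ∈ asympDualCone d Ω' := by
  set M : ℝ := (‖v‖ + |s|) * R with hM
  have hM0 : 0 ≤ M := by positivity
  have hMc : c * (M / c) = M := mul_div_cancel₀ M hc.ne'
  have hMc0 : 0 ≤ M / c := by positivity
  refine ⟨K + R + 1 + M / c, by positivity, ?_⟩
  rintro ⟨h', t'⟩ hq' ht'
  obtain ⟨⟨h, t⟩, hq, hdist⟩ := hclose _ hq'
  have hlin' := hlin _ hq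
  dsimp only at ht' hdist hlin' ⊢
  have hh : ‖h' - h‖ ≤ R :=
    (sq_le_sq₀ (norm_nonneg _) hR).mp (by nlinarith [sq_nonneg (t' - t)])
  have ht : |t' - t| ≤ R :=
    abs_le_of_sq_le_sq (by nlinarith [sq_nonneg ‖h' - h‖]) hR
  have hdiff : |⟪v, h' - h⟫ + s * (t' - t)| ≤ M := by
    calc |⟪v, h' - h⟫ + s * (t' - t)| ≤ |⟪v, h' - h⟫| + |s * (t' - t)| := abs_add_le _ _
      _ ≤ ‖v‖ * R + |s| * R := by
        rw [abs_mul]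
        gcongr
        exact (abs_real_inner_le_norm _ _).trans (by gcongr)
      _ = M := by rw [hM]; ring
  rw [inner_sub_right] at hdiff
  obtain ⟨hd₁, hd₂⟩ := abs_le.mp hdiff
  obtain ⟨ht₁, ht₂⟩ := abs_le.mp ht
  rcases lt_or_ge t' 0 with hneg | hpos
  · rw [abs_of_neg hneg] at ht'
    have htneg : t < 0 := by linarith
    rw [abs_of_neg htneg, Real.sign_of_neg htneg] at hlin'
    rw [Real.sign_of_neg hneg]
    have hlow : M / c < -t := by linarith
    have := mul_lt_mul_of_pos_left hlow hc
    have := hlin' (by linarith)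
    linarith
  · rw [abs_of_nonneg hpos] at ht'
    have htpos : 0 < t := by linarith
    rw [abs_of_pos htpos, Real.sign_of_pos htpos] at hlin'
    rw [Real.sign_of_pos (by linarith)]
    have hlow : M / c < t := by linarith
    have := mul_lt_mul_of_pos_left hlow hc
    have := hlin' (by linarith)
    linarith
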